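/- With the notation of the context, let z₁ = (0, 1/2) and z₂ = (1/2, 1/2). Then: (i) on the subgroup H = {E, R², S, SR²} of D₄ one has ω_{z₁}(X,Y) = −1 whenever X ∈ {R², SR²} and Y ∈ {S, SR²}, and ω_{z₁}(X,Y) = 1 for all other pairs (X,Y) ∈ H × H; (ii) on all of D₄ one has ω_{z₂}(X,Y) = −1 whenever X ∈ {R, R³, S, SR²} and Y ∈ S⟨R⟩, and ω_{z₂}(X,Y) = 1 for all other pairs (X,Y) ∈ D₄ × D₄. -/

import Mathlib

noncomputable section
open Matrix

abbrev Mat2 : Type := Matrix (Fin 2) (Fin 2) ℝ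

/-- The rotation `R` by `π/2` as a unit of the matrix ring. -/
def RU : Mat2ˣ where
  val := !![0, -1; 1, 0]
  inv := !![0, 1; -1, 0]
  val_inv := by rw [Matrix.one_fin_two]; norm_num [Matrix.mul_fin_two]
  inv_val := by rw [Matrix.one_fin_two]; norm_num [Matrix.mul_fin_two]

/-- The reflection `S` as a unit of the matrix ring. -/
def SU : Mat2ˣ where
  val := !![1, 0; 0, -1]
  inv := !![1, 0; 0, -1]
  val_inv := by rw [Matrix.one_fin_two]; norm_num [Matrix.mul_fin_two]
  inv_val := by rw [Matrix.one_fin_two]; norm_num [Matrix.mul_fin_two]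

/-- The semidirect product `M = ℝ² ⋊ GL₂(ℝ)`, with elements written `(a, X)` and
multiplication `(a, X)(b, Y) = (a + Xb, XY)`. -/
@[ext]
structure Motion : Type where
  tr : Fin 2 → ℝ
  mat : Mat2ˣ

namespace Motion

instance : Group Motion where
  mul p q := ⟨p.tr + p.mat.val.mulVec q.tr, p.mat * q.mat⟩
  one := ⟨0, 1⟩
  inv p := ⟨-((↑(p.mat⁻¹) : Mat2).mulVec p.tr), p.mat⁻¹⟩
  mul_assoc a b c := by
    refine Motion.ext ?_ ?_
    · show (a.tr + a.mat.val.mulVec b.tr) + ((a.mat * b.mat).val).mulVec c.tr =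
        a.tr + a.mat.val.mulVec (b.tr + b.mat.val.mulVec c.tr)
      rw [Matrix.mulVec_add, Units.val_mul, ← Matrix.mulVec_mulVec, add_assoc]
    · show a.mat * b.mat * c.mat = a.mat * (b.mat * c.mat)
      exact mul_assoc _ _ _
  one_mul a := by
    refine Motion.ext ?_ ?_
    · show (0 : Fin 2 → ℝ) + (1 : Mat2ˣ).val.mulVec a.tr = a.tr
      simp
    · show 1 * a.mat = a.mat
      simp
  mul_one a := by
    refine Motion.ext ?_ ?_
    · show a.tr + a.mat.val.mulVec 0 = a.tr
      simp
    · show a.mat * 1 = a.mat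
      simp
  inv_mul_cancel a := by
    refine Motion.ext ?_ ?_
    · show -((↑(a.mat⁻¹) : Mat2).mulVec a.tr) + (↑(a.mat⁻¹) : Mat2).mulVec a.tr = 0
      simp
    · show a.mat⁻¹ * a.mat = 1
      simp

end Motion

/-- The rotation subgroup `⟨R⟩ = {E, R, R², R³}` of `D₄`. -/
def rotSet : Set Mat2ˣ := {1, RU, RU ^ 2, RU ^ 3}

/-- The coset of reflections `S⟨R⟩ = {S, SR, SR², SR³}`. -/
def refSet : Set Mat2ˣ := {SU, SU * RU, SU * RU ^ 2, SU * RU ^ 3}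

/-- The dihedral group `D₄` of order 8 generated by `R` and `S`. -/
def D4set : Set Mat2ˣ := rotSet ∪ refSet

/-- The vector `v = (1/2, 1/2)`. -/
def vhalf : Fin 2 → ℝ := ![1/2, 1/2]


/-- The character `χ_z(n) = exp(2πi(z₁n₁ + z₂n₂))` of `ℝ²` (restricted to `ℤ²`). -/
def chiz (z n : Fin 2 → ℝ) : ℂ :=
  Complex.exp (2 * Real.pi * Complex.I * (z 0 * n 0 + z 1 * n 1))

/-- The subgroup `H = {E, R², S, SR²}` of `D₄`. -/
def Hset : Set Mat2ˣ := {1, RU ^ 2, SU, SU * RU ^ 2}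

lemma val_RU : RU.val = !![0, -1; 1, 0] := rfl

lemma val_SU : SU.val = !![1, 0; 0, -1] := rfl

lemma val_RU_sq : (RU ^ 2).val = !![-1, 0; 0, -1] := by
  simp [pow_two, val_RU]

lemma val_RU_cube : (RU ^ 3).val = !![0, 1; -1, 0] := by
  simp [pow_succ, val_RU]

lemma val_SU_mul_RU : (SU * RU).val = !![0, -1; -1, 0] := by
  simp [val_RU, val_SU]

lemma val_SU_mul_RU_sq : (SU * RU ^ 2).val = !![-1, 0; 0, 1] := by
  rw [Units.val_mul, val_RU_sq, val_SU]; simp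

lemma val_SU_mul_RU_cube : (SU * RU ^ 3).val = !![0, 1; 1, 0] := by
  rw [Units.val_mul, val_RU_cube, val_SU]; simp

lemma RU_pow_four : RU ^ 4 = 1 := by
  ext1
  rw [show 4 = 2 + 2 from rfl, pow_add, Units.val_mul, val_RU_sq, Units.val_one,
    Matrix.one_fin_two]
  simp

lemma RU_pow_mod (k : ℕ) : RU ^ k = RU ^ (k % 4) := pow_eq_pow_mod k RU_pow_four

lemma SU_mul_SU : SU * SU = 1 := by
  ext1
  rw [Units.val_mul, val_SU, Units.val_one, Matrix.one_fin_two]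
  simp

lemma RU_mul_SU : RU * SU = SU * RU ^ 3 := by
  ext1
  rw [val_SU_mul_RU_cube, Units.val_mul, val_RU, val_SU]
  simp

lemma RU_pow_mul_SU (k : ℕ) : RU ^ k * SU = SU * RU ^ (3 * k) := by
  induction k with
  | zero => simp
  | succ k ih =>
    rw [pow_succ, mul_assoc, RU_mul_SU, ← mul_assoc, ih, mul_assoc, ← pow_add, mul_add, mul_one]

lemma mem_rotSet_iff {X : Mat2ˣ} : X ∈ rotSet ↔ ∃ k : ℕ, X = RU ^ k := by
  constructor
  · rintro (rfl | rfl | rfl | rfl)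
    exacts [⟨0, by simp⟩, ⟨1, by simp⟩, ⟨2, rfl⟩, ⟨3, rfl⟩]
  · rintro ⟨k, rfl⟩
    rw [RU_pow_mod]
    have := Nat.mod_lt k (show 4 > 0 by norm_num)
    interval_cases k % 4 <;> simp [rotSet]

lemma mem_refSet_iff {X : Mat2ˣ} : X ∈ refSet ↔ ∃ Y ∈ rotSet, X = SU * Y := by
  simp [refSet, rotSet]

lemma rot_mul_rot {X Y : Mat2ˣ} (hX : X ∈ rotSet) (hY : Y ∈ rotSet) : X * Y ∈ rotSet := by
  rw [mem_rotSet_iff] at *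
  obtain ⟨k, rfl⟩ := hX
  obtain ⟨l, rfl⟩ := hY
  exact ⟨k + l, (pow_add _ _ _).symm⟩

lemma ref_mul_rot {X Y : Mat2ˣ} (hX : X ∈ refSet) (hY : Y ∈ rotSet) : X * Y ∈ refSet := by
  rw [mem_refSet_iff] at *
  obtain ⟨X, hX, rfl⟩ := hX
  exact ⟨X * Y, rot_mul_rot hX hY, mul_assoc _ _ _⟩

lemma rot_mul_ref {X Y : Mat2ˣ} (hX : X ∈ rotSet) (hY : Y ∈ refSet) : X * Y ∈ refSet := by
  rw [mem_refSet_iff] at *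
  obtain ⟨Y, hY, rfl⟩ := hY
  obtain ⟨k, rfl⟩ := mem_rotSet_iff.1 hX
  exact ⟨RU ^ (3 * k) * Y, rot_mul_rot (mem_rotSet_iff.2 ⟨_, rfl⟩) hY, by
    rw [← mul_assoc, RU_pow_mul_SU, mul_assoc]⟩

lemma ref_mul_ref {X Y : Mat2ˣ} (hX : X ∈ refSet) (hY : Y ∈ refSet) : X * Y ∈ rotSet := by
  obtain ⟨W, hW, rfl⟩ := mem_refSet_iff.1 hX
  obtain ⟨Z, hZ, h⟩ := mem_refSet_iff.1 (rot_mul_ref hW hY)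
  rwa [mul_assoc, h, ← mul_assoc, SU_mul_SU, one_mul]

lemma det_rot {X : Mat2ˣ} (hX : X ∈ rotSet) : X.val.det = 1 := by
  obtain ⟨k, rfl⟩ := mem_rotSet_iff.1 hX
  simp [val_RU, Matrix.det_fin_two]

lemma det_ref {X : Mat2ˣ} (hX : X ∈ refSet) : X.val.det = -1 := by
  obtain ⟨Y, hY, rfl⟩ := mem_refSet_iff.1 hX
  rw [Units.val_mul, Matrix.det_mul, det_rot hY]
  simp [val_SU, Matrix.det_fin_two]

lemma notMem_refSet_of_mem_rotSet {X : Mat2ˣ} (hX : X ∈ rotSet) : X ∉ refSet := fun h => by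
  have := det_rot hX
  rw [det_ref h] at this
  norm_num at this

/-- The translation part of `(a, X)⁻¹ (b, XY) (d, Y)⁻¹`, multiplied by `X`, is `b - a - Xd`. -/
lemma mulVec_eq_of_coboundary {X Y : Mat2ˣ} {a b d w : Fin 2 → ℝ}
    (h : (⟨a, X⟩ : Motion)⁻¹ * ⟨b, X * Y⟩ * (⟨d, Y⟩ : Motion)⁻¹ = ⟨w, 1⟩) :
    X.val.mulVec (w + d) = b - a := by
  rw [mul_inv_eq_iff_eq_mul, inv_mul_eq_iff_eq_mul] at h
  have h' : b = a + X.val.mulVec (w + (1 : Mat2ˣ).val.mulVec d) := congrArg Motion.tr h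
  rw [Units.val_one, Matrix.one_mulVec] at h'
  rw [h', add_sub_cancel_left]

lemma eq_neg_of_mulVec_add_eq_zero {X : Mat2ˣ} {w d : Fin 2 → ℝ}
    (h : X.val.mulVec (w + d) = 0) : w = -d := by
  have := congrArg ((X⁻¹).val.mulVec) h
  rw [Matrix.mulVec_mulVec, ← Units.val_mul, inv_mul_cancel, Units.val_one, Matrix.one_mulVec,
    Matrix.mulVec_zero] at this
  exact eq_neg_of_add_eq_zero_left this

lemma chiz_eq_one {z n : Fin 2 → ℝ} (k : ℤ) (h : z 0 * n 0 + z 1 * n 1 = k) :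
    chiz z n = 1 := by
  have h' : (z 0 * n 0 + z 1 * n 1 : ℂ) = k := by exact_mod_cast h
  rw [chiz, h', Complex.exp_eq_one_iff]
  exact ⟨k, by ring⟩

lemma chiz_eq_neg_one {z n : Fin 2 → ℝ} (h : z 0 * n 0 + z 1 * n 1 = -1 / 2) :
    chiz z n = -1 := by
  have h' : (z 0 * n 0 + z 1 * n 1 : ℂ) = -1 / 2 := by exact_mod_cast congrArg Complex.ofReal h
  rw [chiz, h', show 2 * (Real.pi : ℂ) * Complex.I * (-1 / 2) = -(Real.pi * Complex.I) by ring,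
    Complex.exp_neg, Complex.exp_pi_mul_I]
  norm_num

lemma chiz_zero (z : Fin 2 → ℝ) : chiz z 0 = 1 := by simp [chiz]

section Values

variable {c : Mat2ˣ → Motion} {dc : Mat2ˣ → Mat2ˣ → (Fin 2 → ℝ)}

lemma dc_rot (hcR : ∀ X ∈ rotSet, c X = ⟨0, X⟩) (hcS : ∀ X ∈ refSet, c X = ⟨vhalf, X⟩)
    (hdc : ∀ X ∈ D4set, ∀ Y ∈ D4set, (c X)⁻¹ * c (X * Y) * (c Y)⁻¹ = ⟨dc X Y, 1⟩)
    {X Y : Mat2ˣ} (hX : X ∈ D4set) (hY : Y ∈ rotSet) : dc X Y = 0 := by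
  have h := hdc X hX Y (Or.inl hY)
  rcases hX with hX | hX
  · rw [hcR X hX, hcR _ (rot_mul_rot hX hY), hcR Y hY] at h
    simpa using eq_neg_of_mulVec_add_eq_zero ((mulVec_eq_of_coboundary h).trans (sub_self _))
  · rw [hcS X hX, hcS _ (ref_mul_rot hX hY), hcR Y hY] at h
    simpa using eq_neg_of_mulVec_add_eq_zero ((mulVec_eq_of_coboundary h).trans (sub_self _))

lemma mulVec_dc_of_rot_ref (hcR : ∀ X ∈ rotSet, c X = ⟨0, X⟩)
    (hcS : ∀ X ∈ refSet, c X = ⟨vhalf, X⟩)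
    (hdc : ∀ X ∈ D4set, ∀ Y ∈ D4set, (c X)⁻¹ * c (X * Y) * (c Y)⁻¹ = ⟨dc X Y, 1⟩)
    {X Y : Mat2ˣ} (hX : X ∈ rotSet) (hY : Y ∈ refSet) :
    X.val.mulVec (dc X Y + vhalf) = vhalf := by
  have h := hdc X (Or.inl hX) Y (Or.inr hY)
  rw [hcR X hX, hcS _ (rot_mul_ref hX hY), hcS Y hY] at h
  simpa using mulVec_eq_of_coboundary h

lemma mulVec_dc_of_ref_ref (hcR : ∀ X ∈ rotSet, c X = ⟨0, X⟩)
    (hcS : ∀ X ∈ refSet, c X = ⟨vhalf, X⟩)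
    (hdc : ∀ X ∈ D4set, ∀ Y ∈ D4set, (c X)⁻¹ * c (X * Y) * (c Y)⁻¹ = ⟨dc X Y, 1⟩)
    {X Y : Mat2ˣ} (hX : X ∈ refSet) (hY : Y ∈ refSet) :
    X.val.mulVec (dc X Y + vhalf) = -vhalf := by
  have h := hdc X (Or.inr hX) Y (Or.inr hY)
  rw [hcS X hX, hcR _ (ref_mul_ref hX hY), hcS Y hY] at h
  simpa using mulVec_eq_of_coboundary h

/-- The values of `∂c(X, Y)` for `Y` a reflection, which do not depend on `Y`. -/
lemma dc_ref (hcR : ∀ X ∈ rotSet, c X = ⟨0, X⟩) (hcS : ∀ X ∈ refSet, c X = ⟨vhalf, X⟩)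
    (hdc : ∀ X ∈ D4set, ∀ Y ∈ D4set, (c X)⁻¹ * c (X * Y) * (c Y)⁻¹ = ⟨dc X Y, 1⟩)
    {Y : Mat2ˣ} (hY : Y ∈ refSet) :
    (dc 1 Y = 0 ∧ dc RU Y = ![0, -1] ∧ dc (RU ^ 2) Y = ![-1, -1] ∧ dc (RU ^ 3) Y = ![-1, 0]) ∧
    dc SU Y = ![-1, 0] ∧ dc (SU * RU) Y = 0 ∧ dc (SU * RU ^ 2) Y = ![0, -1] ∧
      dc (SU * RU ^ 3) Y = ![-1, -1] := by
  have hrot := fun X (hX : X ∈ rotSet) => mulVec_dc_of_rot_ref hcR hcS hdc hX hY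
  have href := fun X (hX : X ∈ refSet) => mulVec_dc_of_ref_ref hcR hcS hdc hX hY
  simp only [rotSet, refSet, Set.mem_insert_iff, Set.mem_singleton_iff, forall_eq_or_imp,
    forall_eq, val_RU, val_SU, val_RU_sq, val_RU_cube, val_SU_mul_RU, val_SU_mul_RU_sq,
    val_SU_mul_RU_cube, Units.val_one, Matrix.one_mulVec, funext_iff, Fin.forall_fin_two,
    vhalf] at hrot href ⊢
  simp [Matrix.mulVec, dotProduct, Fin.sum_univ_two] at hrot href ⊢
  obtain ⟨⟨_, _⟩, ⟨_, _⟩, ⟨_, _⟩, _, _⟩ := hrot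
  obtain ⟨⟨_, _⟩, ⟨_, _⟩, ⟨_, _⟩, _, _⟩ := href
  refine ⟨⟨⟨?_, ?_⟩, ⟨?_, ?_⟩, ⟨?_, ?_⟩, ?_, ?_⟩, ⟨?_, ?_⟩, ⟨?_, ?_⟩, ⟨?_, ?_⟩, ?_, ?_⟩ <;> linarith

end Values

/-- The values of the Mackey obstruction cocycles
`ω_{z₁}` on `H = {E, R², S, SR²}` at `z₁ = (0, 1/2)` and `ω_{z₂}` on all of `D₄` at
`z₂ = (1/2, 1/2)`, where `ω_z(X,Y) = χ_z(∂c(X,Y))`. -/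
theorem stmt_11
    (c : Mat2ˣ → Motion)
    (hcR : ∀ X ∈ rotSet, c X = ⟨0, X⟩)
    (hcS : ∀ X ∈ refSet, c X = ⟨vhalf, X⟩)
    (dc : Mat2ˣ → Mat2ˣ → (Fin 2 → ℝ))
    (hdc : ∀ X ∈ D4set, ∀ Y ∈ D4set, (c X)⁻¹ * c (X * Y) * (c Y)⁻¹ = ⟨dc X Y, 1⟩) :
    (∀ X ∈ Hset, ∀ Y ∈ Hset,
      (X ∈ ({RU ^ 2, SU * RU ^ 2} : Set Mat2ˣ) ∧ Y ∈ ({SU, SU * RU ^ 2} : Set Mat2ˣ) →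
        chiz ![0, 1/2] (dc X Y) = -1) ∧
      (¬(X ∈ ({RU ^ 2, SU * RU ^ 2} : Set Mat2ˣ) ∧ Y ∈ ({SU, SU * RU ^ 2} : Set Mat2ˣ)) →
        chiz ![0, 1/2] (dc X Y) = 1)) ∧
    (∀ X ∈ D4set, ∀ Y ∈ D4set,
      (X ∈ ({RU, RU ^ 3, SU, SU * RU ^ 2} : Set Mat2ˣ) ∧ Y ∈ refSet →
        chiz ![1/2, 1/2] (dc X Y) = -1) ∧
      (¬(X ∈ ({RU, RU ^ 3, SU, SU * RU ^ 2} : Set Mat2ˣ) ∧ Y ∈ refSet) →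
        chiz ![1/2, 1/2] (dc X Y) = 1)) := by
  have hHD : Hset ⊆ D4set := by
    rintro X (rfl | rfl | rfl | rfl) <;> simp [D4set, rotSet, refSet]
  refine ⟨fun X hX Y hY => ?_, fun X hX Y hY => ?_⟩
  · have hY' : (Y ∈ ({SU, SU * RU ^ 2} : Set Mat2ˣ) ∧ Y ∈ refSet) ∨ Y ∈ rotSet := by
      rcases hY with rfl | rfl | rfl | rfl <;> simp [rotSet, refSet]
    rcases hY' with ⟨hYS, hYr⟩ | hYr
    · obtain ⟨⟨h0, -, h2, -⟩, h4, -, h6, -⟩ := dc_ref hcR hcS hdc hYr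
      simp only [hYS, and_true]
      rcases hX with rfl | rfl | rfl | rfl
      · refine ⟨fun h => ?_, fun _ => by rw [h0, chiz_zero]⟩
        simp only [Set.mem_insert_iff, Set.mem_singleton_iff, Units.ext_iff,
          val_RU_sq, val_SU_mul_RU_sq, Units.val_one, Matrix.one_fin_two] at h
        norm_num [← Matrix.ext_iff, Fin.forall_fin_two] at h
      · exact ⟨fun _ => chiz_eq_neg_one (by norm_num [h2]), fun h => absurd (by simp) h⟩
      · refine ⟨fun h => ?_, fun _ => chiz_eq_one 0 (by simp [h4])⟩
        simp only [Set.mem_insert_iff, Set.mem_singleton_iff, Units.ext_iff,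
          val_RU_sq, val_SU_mul_RU_sq, val_SU] at h
        norm_num [← Matrix.ext_iff, Fin.forall_fin_two] at h
      · exact ⟨fun _ => chiz_eq_neg_one (by norm_num [h6]), fun h => absurd (by simp) h⟩
    · refine ⟨fun h => absurd ?_ (notMem_refSet_of_mem_rotSet hYr), fun _ => by
        rw [dc_rot hcR hcS hdc (hHD hX) hYr, chiz_zero]⟩
      rcases h.2 with rfl | rfl <;> simp [refSet]
  · rcases hY with hYr | hYr
    · exact ⟨fun h => absurd h.2 (notMem_refSet_of_mem_rotSet hYr), fun _ => by
        rw [dc_rot hcR hcS hdc hX hYr, chiz_zero]⟩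
    · obtain ⟨⟨h0, h1, h2, h3⟩, h4, h5, h6, h7⟩ := dc_ref hcR hcS hdc hYr
      simp only [hYr, and_true]
      rcases hX with (rfl | rfl | rfl | rfl) | (rfl | rfl | rfl | rfl)
      · refine ⟨fun h => ?_, fun _ => by rw [h0, chiz_zero]⟩
        simp only [Set.mem_insert_iff, Set.mem_singleton_iff, Units.ext_iff,
          val_RU, val_RU_cube, val_SU, val_SU_mul_RU_sq, Units.val_one, Matrix.one_fin_two] at h
        norm_num [← Matrix.ext_iff, Fin.forall_fin_two] at h
      · exact ⟨fun _ => chiz_eq_neg_one (by norm_num [h1]), fun h => absurd (by simp) h⟩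
      · refine ⟨fun h => ?_, fun _ => chiz_eq_one (-1) (by norm_num [h2])⟩
        simp only [Set.mem_insert_iff, Set.mem_singleton_iff, Units.ext_iff,
          val_RU, val_RU_cube, val_SU, val_SU_mul_RU_sq, val_RU_sq] at h
        norm_num [← Matrix.ext_iff, Fin.forall_fin_two] at h
      · exact ⟨fun _ => chiz_eq_neg_one (by norm_num [h3]), fun h => absurd (by simp) h⟩
      · exact ⟨fun _ => chiz_eq_neg_one (by norm_num [h4]), fun h => absurd (by simp) h⟩
      · refine ⟨fun h => ?_, fun _ => by rw [h5, chiz_zero]⟩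
        simp only [Set.mem_insert_iff, Set.mem_singleton_iff, Units.ext_iff,
          val_RU, val_RU_cube, val_SU, val_SU_mul_RU_sq, val_SU_mul_RU] at h
        norm_num [← Matrix.ext_iff, Fin.forall_fin_two] at h
      · exact ⟨fun _ => chiz_eq_neg_one (by norm_num [h6]), fun h => absurd (by simp) h⟩
      · refine ⟨fun h => ?_, fun _ => chiz_eq_one (-1) (by norm_num [h7])⟩
        simp only [Set.mem_insert_iff, Set.mem_singleton_iff, Units.ext_iff,
          val_RU, val_RU_cube, val_SU, val_SU_mul_RU_sq, val_SU_mul_RU_cube] at h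
        norm_num [← Matrix.ext_iff, Fin.forall_fin_two] at h
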